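/- arXiv:1202.5725 — 2 statements merged into one kernel-verified Lean document; each statement's English description precedes it below -/
import Mathlib

section
/- In the Artin group Art(D_n), for all integers i, r with 2 < i < r ≤ n−2 one has the identity w_{r+1} (s_{r−1} s_{r−2} ⋯ s_i) = (s_r s_{r−1} ⋯ s_{i+1}) w_{r+1}. -/
/-- Generators of the Artin group `Art(Dₙ)` : `a = s₁`, `a' = s′₁`,
and `s i` for `2 ≤ i ≤ n − 1`. -/
inductive DGen (n : ℕ) : Type
  | a : DGen n
  | a' : DGen n
  | s : (i : ℕ) → 2 ≤ i → i ≤ n - 1 → DGen n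

/-- The generator `s_i` (for `2 ≤ i ≤ n − 1`) as an element of the free group. -/
def Dfs (n i : ℕ) : FreeGroup (DGen n) :=
  if h : 2 ≤ i ∧ i ≤ n - 1 then FreeGroup.of (DGen.s i h.1 h.2) else 1

/-- The relators of the presentation of the Artin group `Art(Dₙ)` :
`s₁s′₁ = s′₁s₁`; `s₁s₂s₁ = s₂s₁s₂`; `s′₁s₂s′₁ = s₂s′₁s₂`;
`sᵢs_{i+1}sᵢ = s_{i+1}sᵢs_{i+1}` for `2 ≤ i ≤ n−2`;
`sᵢsⱼ = sⱼsᵢ` for `i, j ≥ 2` with `|i−j| ≥ 2`; and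
`s₁sⱼ = sⱼs₁`, `s′₁sⱼ = sⱼs′₁` for `j ≥ 3`. -/
def DRels (n : ℕ) : Set (FreeGroup (DGen n)) :=
  {r | r = FreeGroup.of DGen.a * FreeGroup.of DGen.a' *
          (FreeGroup.of DGen.a' * FreeGroup.of DGen.a)⁻¹ ∨
       r = FreeGroup.of DGen.a * Dfs n 2 * FreeGroup.of DGen.a *
          (Dfs n 2 * FreeGroup.of DGen.a * Dfs n 2)⁻¹ ∨
       r = FreeGroup.of DGen.a' * Dfs n 2 * FreeGroup.of DGen.a' *
          (Dfs n 2 * FreeGroup.of DGen.a' * Dfs n 2)⁻¹ ∨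
       (∃ i : ℕ, 2 ≤ i ∧ i ≤ n - 2 ∧
          r = Dfs n i * Dfs n (i + 1) * Dfs n i *
            (Dfs n (i + 1) * Dfs n i * Dfs n (i + 1))⁻¹) ∨
       (∃ i j : ℕ, 2 ≤ i ∧ i + 2 ≤ j ∧ j ≤ n - 1 ∧
          r = Dfs n i * Dfs n j * (Dfs n j * Dfs n i)⁻¹) ∨
       (∃ j : ℕ, 3 ≤ j ∧ j ≤ n - 1 ∧
          r = FreeGroup.of DGen.a * Dfs n j * (Dfs n j * FreeGroup.of DGen.a)⁻¹) ∨
       (∃ j : ℕ, 3 ≤ j ∧ j ≤ n - 1 ∧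
          r = FreeGroup.of DGen.a' * Dfs n j * (Dfs n j * FreeGroup.of DGen.a')⁻¹)}

/-- The Artin group of type `Dₙ`. -/
abbrev ArtinD (n : ℕ) : Type := PresentedGroup (DRels n)

/-- The generator `s₁` of `Art(Dₙ)`. -/
def Ds1 (n : ℕ) : ArtinD n := PresentedGroup.of DGen.a

/-- The generator `s′₁` of `Art(Dₙ)`. -/
def Ds1' (n : ℕ) : ArtinD n := PresentedGroup.of DGen.a'

/-- The generator `sᵢ` (for `2 ≤ i ≤ n − 1`) of `Art(Dₙ)`. -/
def Ds (n i : ℕ) : ArtinD n :=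
  if h : 2 ≤ i ∧ i ≤ n - 1 then PresentedGroup.of (DGen.s i h.1 h.2) else 1

/-- The element `w_r = s₁s′₁s₂⋯s_r` of `Art(Dₙ)` (for `2 ≤ r ≤ n − 1`). -/
def Dw (n r : ℕ) : ArtinD n :=
  Ds1 n * Ds1' n * ((List.range (r - 1)).map (fun k => Ds n (k + 2))).prod

/-- The Garside element `Δ_r = w_r^{r−1}` of `Art(Dₙ)`. -/
def DDelta (n r : ℕ) : ArtinD n := Dw n r ^ (r - 1)

/-- The element `η_r = s_{r−1}⋯s₂s₁s′₁s₂⋯s_{r−1}` of `Art(Dₙ)`. -/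
def Deta (n r : ℕ) : ArtinD n :=
  ((List.range (r - 2)).reverse.map (fun k => Ds n (k + 2))).prod *
    (Ds1 n * Ds1' n) *
    ((List.range (r - 2)).map (fun k => Ds n (k + 2))).prod

theorem mk_Dfs (n i : ℕ) : PresentedGroup.mk (DRels n) (Dfs n i) = Ds n i := by
  unfold Dfs Ds
  split_ifs
  · rfl
  · exact map_one _

theorem mk_eq_mk_of_mem_DRels {n : ℕ} {x y : FreeGroup (DGen n)} (h : x * y⁻¹ ∈ DRels n) :
    PresentedGroup.mk (DRels n) x = PresentedGroup.mk (DRels n) y := by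
  have := PresentedGroup.one_of_mem h
  rwa [map_mul, map_inv, mul_inv_eq_one] at this

theorem Ds_braid {n i : ℕ} (hi : 2 ≤ i) (hin : i ≤ n - 2) :
    Ds n i * Ds n (i + 1) * Ds n i = Ds n (i + 1) * Ds n i * Ds n (i + 1) := by
  simpa only [map_mul, mk_Dfs] using mk_eq_mk_of_mem_DRels
    (n := n) (Or.inr (Or.inr (Or.inr (Or.inl ⟨i, hi, hin, rfl⟩))))

theorem Ds_commute {n i j : ℕ} (hi : 2 ≤ i) (hij : i + 2 ≤ j) (hj : j ≤ n - 1) :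
    Commute (Ds n i) (Ds n j) := by
  have := mk_eq_mk_of_mem_DRels
    (n := n) (Or.inr (Or.inr (Or.inr (Or.inr (Or.inl ⟨i, j, hi, hij, hj, rfl⟩)))))
  rwa [map_mul, map_mul, mk_Dfs, mk_Dfs] at this

theorem Ds1_commute {n j : ℕ} (h : 3 ≤ j) (hj : j ≤ n - 1) : Commute (Ds1 n) (Ds n j) := by
  have := mk_eq_mk_of_mem_DRels
    (n := n) (Or.inr (Or.inr (Or.inr (Or.inr (Or.inr (Or.inl ⟨j, h, hj, rfl⟩))))))
  rwa [map_mul, map_mul, mk_Dfs] at this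

theorem Ds1'_commute {n j : ℕ} (h : 3 ≤ j) (hj : j ≤ n - 1) : Commute (Ds1' n) (Ds n j) := by
  have := mk_eq_mk_of_mem_DRels
    (n := n) (Or.inr (Or.inr (Or.inr (Or.inr (Or.inr (Or.inr ⟨j, h, hj, rfl⟩))))))
  rwa [map_mul, map_mul, mk_Dfs] at this

theorem Dw_succ (n : ℕ) {m : ℕ} (hm : 1 ≤ m) : Dw n (m + 1) = Dw n m * Ds n (m + 1) := by
  obtain ⟨m, rfl⟩ := Nat.exists_eq_add_of_le' hm
  simp [Dw, List.range_succ, mul_assoc]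

theorem Dw_commute {n m j : ℕ} (hm : 1 ≤ m) (hmj : m + 2 ≤ j) (hj : j ≤ n - 1) :
    Commute (Dw n m) (Ds n j) := by
  induction m, hm using Nat.le_induction with
  | base =>
    simpa [Dw] using (Ds1_commute hmj hj).mul_left (Ds1'_commute hmj hj)
  | succ m hm ih =>
    rw [Dw_succ n hm]
    exact (ih (by omega)).mul_left (Ds_commute (by omega) hmj hj)

/-- Conjugation by `w_m` shifts the generators `s_j` with `2 ≤ j < m`. -/
theorem Dw_semiconjBy {n m j : ℕ} (hj : 2 ≤ j) (hjm : j + 1 ≤ m) (hm : m ≤ n - 1) :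
    SemiconjBy (Dw n m) (Ds n j) (Ds n (j + 1)) := by
  induction m, hjm using Nat.le_induction with
  | base =>
    obtain ⟨k, rfl⟩ := Nat.exists_eq_add_of_le' (show 1 ≤ j by omega)
    have hbraid := Ds_braid hj (show k + 1 ≤ n - 2 by omega)
    have hcomm : Commute (Dw n k) (Ds n (k + 1 + 1)) := Dw_commute (by omega) le_rfl hm
    rw [Dw_succ n (by omega), Dw_succ n (by omega), mul_assoc]
    refine SemiconjBy.mul_left hcomm ?_
    rw [SemiconjBy, hbraid, mul_assoc]
  | succ m hjm ih =>
    rw [Dw_succ n (by omega)]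
    exact (ih (by omega)).mul_left (Ds_commute hj (by omega) hm).symm

theorem SemiconjBy.list_prod_map {M ι : Type*} [Monoid M] {w : M} {f g : ι → M} (l : List ι)
    (h : ∀ k ∈ l, SemiconjBy w (f k) (g k)) : SemiconjBy w (l.map f).prod (l.map g).prod := by
  induction l with
  | nil => exact SemiconjBy.one_right w
  | cons a l ih =>
    simp only [List.map_cons, List.prod_cons]
    exact (h a List.mem_cons_self).mul_right (ih fun k hk => h k (List.mem_cons_of_mem a hk))

/-- In the Artin group `Art(Dₙ)`, for all `i, r` with `2 < i < r ≤ n − 2`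
one has `w_{r+1} (s_{r−1} s_{r−2} ⋯ s_i) = (s_r s_{r−1} ⋯ s_{i+1}) w_{r+1}`. -/
theorem ArtinD_w_mul_desc (n i r : ℕ) (hn : 3 ≤ n) (hi : 2 < i) (hir : i < r)
    (hrn : r ≤ n - 2) :
    Dw n (r + 1) * ((List.range (r - i)).map (fun k => Ds n (r - 1 - k))).prod =
      ((List.range (r - i)).map (fun k => Ds n (r - k))).prod * Dw n (r + 1) := by
  refine SemiconjBy.list_prod_map _ fun k hk => ?_
  rw [List.mem_range] at hk
  rw [show r - k = r - 1 - k + 1 by omega]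
  exact Dw_semiconjBy (by omega) (by omega) (by omega)
end

section
/- Let j = exp(2πi/3) and √−3 = j − j². Let s̄₁ = [[1, 0], [0, j]] and s̄₂ = (1/√−3)·[[−1, j], [2, j]] in GL₂(ℂ), and let W ≤ GL₂(ℂ) be the subgroup they generate (the exceptional complex reflection group G₄). Let W act on the polynomial ring ℂ[z₁, z₂] by linear substitution of the variables. Then the subalgebra ℂ[z₁, z₂]^W of W-invariant polynomials equals the ℂ-subalgebra generated by g₁ = z₁⁴ − z₁z₂³ and g₂ = z₁⁶ + (5/2)z₁³z₂³ − (1/8)z₂⁶. -/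
open MvPolynomial Complex

/-- The action of `g ∈ GL₂(ℂ)` on `ℂ[z₁, z₂]` by substituting for the variables their
images under the linear map given by `g` : `X i ↦ ∑ j, g i j • X j`. -/
noncomputable def glSubst (g : GL (Fin 2) ℂ) :
    MvPolynomial (Fin 2) ℂ →ₐ[ℂ] MvPolynomial (Fin 2) ℂ :=
  aeval (fun i => ∑ j, C ((g : Matrix (Fin 2) (Fin 2) ℂ) i j) * X j)

/-- Substitution is compatible with products of matrices. -/
theorem glSubst_mul (g h : GL (Fin 2) ℂ) (p : MvPolynomial (Fin 2) ℂ) :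
    glSubst (g * h) p = glSubst h (glSubst g p) := by
  have : glSubst (g * h) = (glSubst h).comp (glSubst g) := by
    ext i : 1
    simp [glSubst, Matrix.mul_apply, Fin.sum_univ_two]
    ring
  rw [this, AlgHom.comp_apply]

theorem glSubst_one (p : MvPolynomial (Fin 2) ℂ) : glSubst 1 p = p := by
  have : glSubst 1 = AlgHom.id ℂ _ := by
    ext i : 1
    fin_cases i <;> simp [glSubst, Fin.sum_univ_two]
  rw [this, AlgHom.id_apply]

/-- A polynomial fixed by a set of matrices is fixed by the subgroup they generate. -/
theorem glSubst_eq_of_mem_closure {S : Set (GL (Fin 2) ℂ)} {p : MvPolynomial (Fin 2) ℂ}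
    (hS : ∀ g ∈ S, glSubst g p = p) {g : GL (Fin 2) ℂ} (hg : g ∈ Subgroup.closure S) :
    glSubst g p = p := by
  induction hg using Subgroup.closure_induction with
  | mem x hx => exact hS x hx
  | one => exact glSubst_one p
  | mul x y _ _ hx hy => rw [glSubst_mul, hx, hy]
  | inv x _ hx =>
    conv_lhs => rw [← hx]
    rw [← glSubst_mul, mul_inv_cancel, glSubst_one]

/-- The restriction of a binary polynomial to the line `z₁ = c z₂`. -/
noncomputable def restrictLine (c : ℂ) : MvPolynomial (Fin 2) ℂ →ₐ[ℂ] Polynomial ℂ :=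
  aeval ![Polynomial.C c * Polynomial.X, Polynomial.X]

@[simp] theorem restrictLine_X_zero (c : ℂ) :
    restrictLine c (X 0) = Polynomial.C c * Polynomial.X := by
  simp [restrictLine]

@[simp] theorem restrictLine_X_one (c : ℂ) : restrictLine c (X 1) = Polynomial.X := by
  simp [restrictLine]

@[simp] theorem restrictLine_C (c a : ℂ) : restrictLine c (C a) = Polynomial.C a := by
  simp [restrictLine, Polynomial.algebraMap_eq]

/-- A binary polynomial vanishing on a line is divisible by the equation of the line. -/
theorem dvd_of_restrictLine_eq_zero {c : ℂ} {p : MvPolynomial (Fin 2) ℂ}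
    (h : restrictLine c p = 0) : X 0 - C c * X 1 ∣ p := by
  set I : Ideal (MvPolynomial (Fin 2) ℂ) := Ideal.span {X 0 - C c * X 1}
  have key : (Ideal.Quotient.mkₐ ℂ I) =
      ((Ideal.Quotient.mkₐ ℂ I).comp (Polynomial.aeval (X 1))).comp (restrictLine c) := by
    ext i : 1
    fin_cases i
    · simp [-Ideal.Quotient.mk_eq_mk]
      rw [← map_mul, Ideal.Quotient.eq]
      exact Ideal.subset_span rfl
    · simp
  have hp := DFunLike.congr_fun key p
  rw [AlgHom.comp_apply, h, map_zero] at hp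
  exact Ideal.mem_span_singleton.mp (Ideal.Quotient.eq_zero_iff_mem.mp hp)

theorem restrictLine_eq_zero_of_mul {c d : ℂ} (hcd : c ≠ d) {q : MvPolynomial (Fin 2) ℂ}
    (h : restrictLine c ((X 0 - C d * X 1) * q) = 0) : restrictLine c q = 0 := by
  have h1 : restrictLine c (X 0 - C d * X 1) ≠ 0 := by
    have : restrictLine c (X 0 - C d * X 1) = Polynomial.C (c - d) * Polynomial.X := by
      simp
      ring
    rw [this]
    simpa [sub_eq_zero] using hcd
  rw [map_mul] at h
  exact (mul_eq_zero.mp h).resolve_left h1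

theorem prod_lines_dvd {s : Finset ℂ} {p : MvPolynomial (Fin 2) ℂ}
    (h : ∀ c ∈ s, restrictLine c p = 0) : ∏ c ∈ s, (X 0 - C c * X 1) ∣ p := by
  induction s using Finset.induction_on generalizing p with
  | empty => simp
  | insert a s ha ih =>
    obtain ⟨q, rfl⟩ := dvd_of_restrictLine_eq_zero (h a (Finset.mem_insert_self a s))
    rw [Finset.prod_insert ha]
    refine mul_dvd_mul_left _ (ih fun c hc => ?_)
    exact restrictLine_eq_zero_of_mul (by rintro rfl; exact ha hc)
      (h c (Finset.mem_insert_of_mem hc))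

theorem natDegree_restrictLine_le (c : ℂ) (p : MvPolynomial (Fin 2) ℂ) :
    (restrictLine c p).natDegree ≤ p.totalDegree := by
  refine (aeval_natDegree_le p le_rfl _ (n := 1) fun i => ?_).trans (mul_one _).le
  fin_cases i
  · exact (Polynomial.natDegree_C_mul_le _ _).trans Polynomial.natDegree_X_le
  · exact Polynomial.natDegree_X_le

theorem totalDegree_aeval_le (g : MvPolynomial (Fin 2) ℂ) (Q : Polynomial ℂ) :
    (Polynomial.aeval g Q).totalDegree ≤ Q.natDegree * g.totalDegree := by
  rw [Polynomial.aeval_eq_sum_range]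
  refine (totalDegree_finsetSum _ _).trans (Finset.sup_le fun i hi => ?_)
  refine (totalDegree_smul_le _ _).trans ((totalDegree_pow _ _).trans ?_)
  exact Nat.mul_le_mul_right _ (Nat.lt_succ_iff.mp (Finset.mem_range.mp hi))

/-- A univariate polynomial invariant under scaling by a cube root of unity and by `-1` is a
polynomial in the sixth power of the variable. -/
theorem exists_expand_six {j : ℂ} (hj : IsPrimitiveRoot j 3) {P : Polynomial ℂ}
    (h1 : P.comp (Polynomial.C j * Polynomial.X) = P)
    (h2 : P.comp (Polynomial.C (-1) * Polynomial.X) = P) :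
    ∃ Q, Polynomial.expand ℂ 6 Q = P := by
  refine ⟨Polynomial.contract 6 P, ?_⟩
  ext n
  rw [Polynomial.coeff_expand (by norm_num)]
  split_ifs with h
  · rw [Polynomial.coeff_contract (by norm_num), Nat.div_mul_cancel h]
  · by_contra! hne
    have a1 := congrArg (fun R => Polynomial.coeff R n) h1
    have a2 := congrArg (fun R => Polynomial.coeff R n) h2
    simp only [Polynomial.comp_C_mul_X_coeff] at a1 a2
    have b1 : 3 ∣ n := hj.dvd_of_pow_eq_one n (mul_left_cancel₀ hne.symm (by rw [a1, mul_one]))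
    have b2 : 2 ∣ n := (IsPrimitiveRoot.neg_one 0 (by norm_num)).dvd_of_pow_eq_one n
      (mul_left_cancel₀ hne.symm (by rw [a2, mul_one]))
    omega

theorem glSubst_X (g : GL (Fin 2) ℂ) (i : Fin 2) :
    glSubst g (X i) = C ((g : Matrix (Fin 2) (Fin 2) ℂ) i 0) * X 0 +
      C ((g : Matrix (Fin 2) (Fin 2) ℂ) i 1) * X 1 := by
  simp [glSubst, Fin.sum_univ_two]

theorem glSubst_C (g : GL (Fin 2) ℂ) (a : ℂ) : glSubst g (C a) = C a := by
  simp [glSubst]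

/-- A matrix preserving the line `z₁ = 0` acts on restrictions to it by scaling. -/
theorem restrictLine_glSubst {g : GL (Fin 2) ℂ}
    (hg : (g : Matrix (Fin 2) (Fin 2) ℂ) 0 1 = 0) (p : MvPolynomial (Fin 2) ℂ) :
    restrictLine 0 (glSubst g p) = (restrictLine 0 p).comp
      (Polynomial.C ((g : Matrix (Fin 2) (Fin 2) ℂ) 1 1) * Polynomial.X) := by
  have : (restrictLine 0).comp (glSubst g) = (Polynomial.aeval
      (Polynomial.C ((g : Matrix (Fin 2) (Fin 2) ℂ) 1 1) * Polynomial.X)).comp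
        (restrictLine 0) := by
    ext i : 1
    fin_cases i <;> simp [glSubst_X, hg]
  exact DFunLike.congr_fun this p

/-- The quartic basic invariant of `G₄`. -/
noncomputable def quarticInvariant : MvPolynomial (Fin 2) ℂ := X 0 ^ 4 - X 0 * X 1 ^ 3

/-- The sextic basic invariant of `G₄`. -/
noncomputable def sexticInvariant : MvPolynomial (Fin 2) ℂ :=
  X 0 ^ 6 + C (5/2 : ℂ) * X 0 ^ 3 * X 1 ^ 3 - C (1/8 : ℂ) * X 1 ^ 6

theorem quarticInvariant_eq_prod {j : ℂ} (hj : IsPrimitiveRoot j 3) :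
    quarticInvariant = ∏ c ∈ ({0, 1, j, j ^ 2} : Finset ℂ), (X 0 - C c * X 1) := by
  have h1 : j ≠ 1 := hj.ne_one (by norm_num)
  have h0 : j ≠ 0 := hj.ne_zero (by norm_num)
  have h2 : j ^ 2 ≠ 1 := hj.pow_ne_one_of_pos_of_lt (by norm_num) (by norm_num)
  have h3 : j ≠ j ^ 2 := fun h => h1 (mul_left_cancel₀ h0 (by rw [← sq, mul_one, ← h]))
  have hs : j ^ 2 + j + 1 = 0 := by
    have := hj.geom_sum_eq_zero (by norm_num)
    simp [Finset.sum_range_succ] at this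
    linear_combination this
  rw [Finset.prod_insert (by simp [h0.symm, (pow_ne_zero 2 h0).symm]), Finset.prod_insert (by simp [h1.symm, h2.symm]),
    Finset.prod_insert (by simp [h3]), Finset.prod_singleton]
  have hC : (C j ^ 2 + C j + 1 : MvPolynomial (Fin 2) ℂ) = 0 := by
    rw [← C_pow, ← C_add, ← C_1, ← C_add, hs, C_0]
  simp only [quarticInvariant, C_0, C_1, C_pow]
  grind

theorem restrictLine_zero_aeval_sexticInvariant (Q : Polynomial ℂ) :
    restrictLine 0 (Polynomial.aeval (C (-8) * sexticInvariant) Q) =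
      Polynomial.expand ℂ 6 Q := by
  have : (restrictLine 0).comp (Polynomial.aeval (C (-8) * sexticInvariant)) =
      Polynomial.expand ℂ 6 := by
    ext : 1
    simp [sexticInvariant, ← Polynomial.C_mul, ← mul_assoc]
  exact DFunLike.congr_fun this Q

theorem totalDegree_quarticInvariant_pos : 0 < quarticInvariant.totalDegree := by
  refine Nat.pos_of_ne_zero fun h => ?_
  have h1 := natDegree_restrictLine_le 2 quarticInvariant
  have h2 : restrictLine 2 quarticInvariant = Polynomial.C 14 * Polynomial.X ^ 4 := by
    simp [quarticInvariant, map_ofNat Polynomial.C]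
    ring
  rw [h, h2, Polynomial.natDegree_C_mul_X_pow _ _ (by norm_num)] at h1
  omega

theorem totalDegree_sexticInvariant_le : (C (-8) * sexticInvariant).totalDegree ≤ 6 := by
  have h : IsHomogeneous (C (-8) * sexticInvariant) 6 :=
    (((isHomogeneous_X_pow 0 6).add
      (((isHomogeneous_C_mul_X_pow (5/2 : ℂ) 0 3).mul (isHomogeneous_X_pow 1 3)))).sub
        (isHomogeneous_C_mul_X_pow (1/8 : ℂ) 1 6)).C_mul _
  exact h.totalDegree_le

theorem glSubst_basic_of_eq_diag {j : ℂ} (hj : j ^ 2 + j + 1 = 0) {g : GL (Fin 2) ℂ}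
    (hg : (g : Matrix (Fin 2) (Fin 2) ℂ) = !![1, 0; 0, j]) :
    glSubst g quarticInvariant = quarticInvariant ∧
      glSubst g sexticInvariant = sexticInvariant := by
  have hC : (C j ^ 3 : MvPolynomial (Fin 2) ℂ) = 1 := by
    rw [← C_pow, ← C_1]
    congr 1
    linear_combination (j - 1) * hj
  constructor
  · simp only [quarticInvariant, map_sub, map_mul, map_pow, glSubst_X, hg]
    simp only [Matrix.of_apply, Matrix.cons_val', Matrix.cons_val_zero, Matrix.cons_val_one,
      Matrix.cons_val_fin_one, C_0, C_1]
    linear_combination (-(X 0 * X 1 ^ 3)) * hC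
  · simp only [sexticInvariant, map_sub, map_add, map_mul, map_pow, glSubst_X, glSubst_C, hg]
    simp only [Matrix.of_apply, Matrix.cons_val', Matrix.cons_val_zero, Matrix.cons_val_one,
      Matrix.cons_val_fin_one, C_0, C_1]
    linear_combination (C (5/2) * X 0 ^ 3 * X 1 ^ 3 - C (1/8) * X 1 ^ 6 * (C j ^ 3 + 1)) * hC

theorem glSubst_basic_of_eq_smul {j : ℂ} (hj : j ^ 2 + j + 1 = 0) {g : GL (Fin 2) ℂ}
    (hg : (g : Matrix (Fin 2) (Fin 2) ℂ) = (j - j ^ 2)⁻¹ • !![-1, j; 2, j]) :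
    glSubst g quarticInvariant = quarticInvariant ∧
      glSubst g sexticInvariant = sexticInvariant := by
  have hk : 3 * ((j - j ^ 2)⁻¹) ^ 2 = -1 := by
    have h : (j - j ^ 2) ^ 2 = -3 := by linear_combination (j ^ 2 - 3 * j + 3) * hj
    rw [inv_pow, h]
    norm_num
  generalize (j - j ^ 2)⁻¹ = k at *
  have hK : (3 * C k ^ 2 : MvPolynomial (Fin 2) ℂ) = -1 := by
    have := congrArg (C : ℂ → MvPolynomial (Fin 2) ℂ) hk
    simpa [map_ofNat C] using this
  have hC : (C j ^ 3 : MvPolynomial (Fin 2) ℂ) = 1 := by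
    rw [← C_pow, ← C_1]
    congr 1
    linear_combination (j - 1) * hj
  have hB : (8 * C (1/8) : MvPolynomial (Fin 2) ℂ) = 1 := by
    have : (8 : MvPolynomial (Fin 2) ℂ) = C 8 := (map_ofNat C 8).symm
    rw [this, ← C_mul, ← C_1]
    norm_num
  have hA : (C (5/2) : MvPolynomial (Fin 2) ℂ) = 20 * C (1/8) := by
    have : (20 : MvPolynomial (Fin 2) ℂ) = C 20 := (map_ofNat C 20).symm
    rw [this, ← C_mul]
    norm_num
  have h4 : (9 * C k ^ 4 : MvPolynomial (Fin 2) ℂ) = 1 := by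
    linear_combination (3 * C k ^ 2 - 1) * hK
  have h6 : (27 * C k ^ 6 : MvPolynomial (Fin 2) ℂ) = -1 := by
    linear_combination (3 * C k ^ 2) * h4 + hK
  constructor
  · simp only [quarticInvariant, map_sub, map_mul, map_pow, glSubst_X, hg]
    simp [map_ofNat C]
    linear_combination (-9 * C k ^ 4 * X 0 * X 1 ^ 3) * hC + (X 0 ^ 4 - X 0 * X 1 ^ 3) * h4
  · simp only [sexticInvariant, map_sub, map_add, map_mul, map_pow, glSubst_X, glSubst_C, hg, hA]
    simp only [Matrix.smul_apply, Matrix.of_apply, Matrix.cons_val', Matrix.cons_val_zero,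
      Matrix.cons_val_one, Matrix.cons_val_fin_one, smul_eq_mul, map_mul, map_neg, map_one,
      map_ofNat]
    generalize (C (1/8) : MvPolynomial (Fin 2) ℂ) = B at *
    generalize (C k : MvPolynomial (Fin 2) ℂ) = k at *
    generalize (C j : MvPolynomial (Fin 2) ℂ) = j at *
    generalize (X 0 : MvPolynomial (Fin 2) ℂ) = x at *
    generalize (X 1 : MvPolynomial (Fin 2) ℂ) = y at *
    have e : (k * -1 * x + k * j * y) ^ 6
        + 20 * B * (k * -1 * x + k * j * y) ^ 3 * (k * 2 * x + k * j * y) ^ 3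
        - B * (k * 2 * x + k * j * y) ^ 6
        = -27 * k ^ 6 * (x ^ 6 + 20 * B * x ^ 3 * (j ^ 3 * y ^ 3) - B * (j ^ 3) ^ 2 * y ^ 6) := by
      have hx : ∀ z : MvPolynomial (Fin 2) ℂ, z = 8 * B * z := fun z => by rw [hB, one_mul]
      rw [hx ((k * -1 * x + k * j * y) ^ 6), hx (x ^ 6)]
      ring
    rw [hC] at e
    linear_combination e - (x ^ 6 + 20 * B * x ^ 3 * y ^ 3 - B * y ^ 6) * h6

/-- The first reflection generating `G₄`. -/
noncomputable def reflectionOne (j : ℂ) (hj : j ^ 2 + j + 1 = 0) : GL (Fin 2) ℂ :=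
  Matrix.GeneralLinearGroup.mkOfDetNeZero !![1, 0; 0, j] (by
    rw [Matrix.det_fin_two_of]
    rintro h
    have : j = 0 := by linear_combination h
    simp [this] at hj)

/-- The second reflection generating `G₄`. -/
noncomputable def reflectionTwo (j : ℂ) (hj : j ^ 2 + j + 1 = 0) : GL (Fin 2) ℂ :=
  Matrix.GeneralLinearGroup.mkOfDetNeZero ((j - j ^ 2)⁻¹ • !![-1, j; 2, j]) (by
    have h0 : j ≠ 0 := by
      rintro rfl
      simp at hj
    have h : (j - j ^ 2) ^ 2 = -3 := by linear_combination (j ^ 2 - 3 * j + 3) * hj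
    have hne : j - j ^ 2 ≠ 0 := by
      intro h'
      rw [h'] at h
      norm_num at h
    have h3 : -1 * j - j * 2 ≠ 0 := by
      have : -1 * j - j * 2 = -3 * j := by ring
      rw [this]
      exact mul_ne_zero (by norm_num) h0
    rw [Matrix.det_smul, Matrix.det_fin_two_of]
    exact mul_ne_zero (pow_ne_zero _ (inv_ne_zero hne)) h3)

theorem coe_reflectionOne_mul_reflectionTwo_pow (j : ℂ) (hj : j ^ 2 + j + 1 = 0) :
    (((reflectionOne j hj * reflectionTwo j hj) ^ 3 : GL (Fin 2) ℂ) :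
      Matrix (Fin 2) (Fin 2) ℂ) = !![-1, 0; 0, -1] := by
  have h : (j - j ^ 2)⁻¹ = -(1 + 2 * j) / 3 := by
    refine inv_eq_of_mul_eq_one_right ?_
    linear_combination (2 * j - 3) / 3 * hj
  have c1 : (reflectionOne j hj : Matrix (Fin 2) (Fin 2) ℂ) = !![1, 0; 0, j] := rfl
  have c2 : (reflectionTwo j hj : Matrix (Fin 2) (Fin 2) ℂ) =
    (j - j ^ 2)⁻¹ • !![-1, j; 2, j] := rfl
  rw [Units.val_pow_eq_pow_val, Units.val_mul, c1, c2, h, pow_succ, pow_two]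
  ext a b
  fin_cases a <;> fin_cases b <;> simp [Matrix.mul_apply, Fin.sum_univ_two] <;> grind

/-- An invariant of `G₄` vanishing on the line `z₁ = 0` is divisible by the quartic one. -/
theorem quarticInvariant_dvd {j : ℂ} (hj : IsPrimitiveRoot j 3) (hs : j ^ 2 + j + 1 = 0)
    {p : MvPolynomial (Fin 2) ℂ}
    (h1 : glSubst (reflectionOne j hs) p = p) (h2 : glSubst (reflectionTwo j hs) p = p)
    (h0 : restrictLine 0 p = 0) : quarticInvariant ∣ p := by
  have c1 : (reflectionOne j hs : Matrix (Fin 2) (Fin 2) ℂ) = !![1, 0; 0, j] := rfl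
  have c2 : (reflectionTwo j hs : Matrix (Fin 2) (Fin 2) ℂ) =
    (j - j ^ 2)⁻¹ • !![-1, j; 2, j] := rfl
  have transport : ∀ {c d : ℂ} {g : GL (Fin 2) ℂ}, glSubst g p = p →
      restrictLine d (glSubst g (X 0 - C c * X 1)) = 0 → restrictLine c p = 0 →
      restrictLine d p = 0 := by
    intro c d g hg hd hc
    obtain ⟨q, hq⟩ := dvd_of_restrictLine_eq_zero hc
    rw [← hg, hq, map_mul, map_mul, hd, zero_mul]
  have hj3 : (Polynomial.C j) ^ 3 = 1 := by rw [← Polynomial.C_pow, hj.pow_eq_one, Polynomial.C_1]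
  have hJ : restrictLine j p = 0 := transport h2 (by
    simp [glSubst_X, c2]
    ring) h0
  have hJ2 : restrictLine (j ^ 2) p = 0 := transport h1 (by
    simp [glSubst_X, c1]
    ring) hJ
  have hJ3 : restrictLine 1 p = 0 := transport h1 (by
    simp [glSubst_X, c1]
    linear_combination (-Polynomial.X) * hj3) hJ2
  rw [quarticInvariant_eq_prod hj]
  refine prod_lines_dvd fun c hc => ?_
  simp only [Finset.mem_insert, Finset.mem_singleton] at hc
  rcases hc with rfl | rfl | rfl | rfl
  exacts [h0, hJ3, hJ, hJ2]

theorem mem_adjoin_of_glSubst_eq {j : ℂ} (hj : IsPrimitiveRoot j 3) (hs : j ^ 2 + j + 1 = 0)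
    {p : MvPolynomial (Fin 2) ℂ}
    (h1 : glSubst (reflectionOne j hs) p = p) (h2 : glSubst (reflectionTwo j hs) p = p) :
    p ∈ Algebra.adjoin ℂ {quarticInvariant, sexticInvariant} := by
  induction hn : p.totalDegree using Nat.strong_induction_on generalizing p with
  | _ n ih =>
  subst hn
  obtain ⟨q1, s1⟩ := glSubst_basic_of_eq_diag hs (g := reflectionOne j hs) rfl
  obtain ⟨q2, s2⟩ := glSubst_basic_of_eq_smul hs (g := reflectionTwo j hs) rfl
  have hneg := coe_reflectionOne_mul_reflectionTwo_pow j hs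
  have h12 : glSubst ((reflectionOne j hs * reflectionTwo j hs) ^ 3) p = p := by
    simp [pow_succ, glSubst_mul, h1, h2]
  have k1 := restrictLine_glSubst (g := reflectionOne j hs) (by rfl) p
  have k2 := restrictLine_glSubst (g := (reflectionOne j hs * reflectionTwo j hs) ^ 3)
    (by rw [hneg]; rfl) p
  rw [h1] at k1
  rw [h12, hneg] at k2
  obtain ⟨Q, hQ⟩ := exists_expand_six hj k1.symm k2.symm
  set r := Polynomial.aeval (C (-8) * sexticInvariant) Q with hr
  have fix : ∀ g, glSubst g sexticInvariant = sexticInvariant → glSubst g r = r := by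
    intro g hg
    rw [hr, ← Polynomial.aeval_algHom_apply, map_mul, hg, glSubst_C]
  have hrdeg : r.totalDegree ≤ p.totalDegree := by
    have a := totalDegree_aeval_le (C (-8) * sexticInvariant) Q
    have b := natDegree_restrictLine_le 0 p
    rw [← hQ, Polynomial.natDegree_expand] at b
    exact a.trans ((Nat.mul_le_mul_left _ totalDegree_sexticInvariant_le).trans b)
  have hrmem : r ∈ Algebra.adjoin ℂ {quarticInvariant, sexticInvariant} := by
    have hs' : sexticInvariant ∈ Algebra.adjoin ℂ {quarticInvariant, sexticInvariant} :=
      Algebra.subset_adjoin (by simp)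
    have hs8 : C (-8) * sexticInvariant ∈
        Algebra.adjoin ℂ {quarticInvariant, sexticInvariant} :=
      mul_mem (Subalgebra.algebraMap_mem _ (-8)) hs'
    exact Algebra.adjoin_le (Set.singleton_subset_iff.mpr hs8)
      (Polynomial.aeval_mem_adjoin_singleton ℂ _)
  have hd1 : glSubst (reflectionOne j hs) (p - r) = p - r := by rw [map_sub, h1, fix _ s1]
  have hd2 : glSubst (reflectionTwo j hs) (p - r) = p - r := by rw [map_sub, h2, fix _ s2]
  obtain ⟨q, hq⟩ := quarticInvariant_dvd hj hs hd1 hd2 (by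
    rw [map_sub, hr, restrictLine_zero_aeval_sexticInvariant, hQ, sub_self])
  have hg0 : quarticInvariant ≠ 0 := by
    intro h
    simpa [h] using totalDegree_quarticInvariant_pos
  have hp : p = quarticInvariant * q + r := by rw [← hq, sub_add_cancel]
  rcases eq_or_ne q 0 with rfl | hq0
  · rw [hp, mul_zero, zero_add]
    exact hrmem
  have hlt : q.totalDegree < p.totalDegree := by
    have a : (p - r).totalDegree ≤ p.totalDegree :=
      (totalDegree_sub _ _).trans (max_le le_rfl hrdeg)
    rw [hq, totalDegree_mul_of_isDomain hg0 hq0] at a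
    have := totalDegree_quarticInvariant_pos
    omega
  have hqfix : ∀ g, glSubst g quarticInvariant = quarticInvariant →
      glSubst g (p - r) = p - r → glSubst g q = q := by
    intro g hg hpr
    rw [hq, map_mul, hg] at hpr
    exact mul_left_cancel₀ hg0 hpr
  have hqmem := ih _ hlt (hqfix _ q1 hd1) (hqfix _ q2 hd2) rfl
  rw [hp]
  exact add_mem (mul_mem (Algebra.subset_adjoin (by simp)) hqmem) hrmem

/-- Let `j = exp(2πi/3)`, `√−3 = j − j²`, `s̄₁ = [[1, 0], [0, j]]`,
`s̄₂ = (1/√−3)·[[−1, j], [2, j]]`, and let `W ≤ GL₂(ℂ)` be the subgroup they generate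
(the exceptional complex reflection group `G₄`). Then the `W`-invariant polynomials in
`ℂ[z₁, z₂]` are exactly the elements of the subalgebra generated by
`g₁ = z₁⁴ − z₁z₂³` and `g₂ = z₁⁶ + (5/2)z₁³z₂³ − (1/8)z₂⁶`. -/
theorem invariants_of_G4_reflection_group
    (j : ℂ) (hj : j = Complex.exp (2 * Real.pi * Complex.I / 3))
    (W : Subgroup (GL (Fin 2) ℂ))
    (hW : W = Subgroup.closure
      {g : GL (Fin 2) ℂ |
        (g : Matrix (Fin 2) (Fin 2) ℂ) = !![1, 0; 0, j] ∨
        (g : Matrix (Fin 2) (Fin 2) ℂ) = (j - j ^ 2)⁻¹ • !![-1, j; 2, j]}) :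
    ∀ p : MvPolynomial (Fin 2) ℂ,
      (∀ g ∈ W, glSubst g p = p) ↔
      p ∈ Algebra.adjoin ℂ
        ({X 0 ^ 4 - X 0 * X 1 ^ 3,
          X 0 ^ 6 + C (5/2 : ℂ) * X 0 ^ 3 * X 1 ^ 3 - C (1/8 : ℂ) * X 1 ^ 6} :
          Set (MvPolynomial (Fin 2) ℂ)) := by
  have hprim : IsPrimitiveRoot j 3 := by
    rw [hj]
    exact_mod_cast Complex.isPrimitiveRoot_exp 3 (by norm_num)
  have hs : j ^ 2 + j + 1 = 0 := by
    have := hprim.geom_sum_eq_zero (by norm_num)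
    simp [Finset.sum_range_succ] at this
    linear_combination this
  intro p
  constructor
  · intro h
    refine mem_adjoin_of_glSubst_eq hprim hs (h _ ?_) (h _ ?_)
    · exact hW ▸ Subgroup.subset_closure (Or.inl rfl)
    · exact hW ▸ Subgroup.subset_closure (Or.inr rfl)
  · intro hp g hg
    rw [hW] at hg
    refine glSubst_eq_of_mem_closure (fun g hg => ?_) hg
    obtain ⟨hg4, hg6⟩ : glSubst g quarticInvariant = quarticInvariant ∧
        glSubst g sexticInvariant = sexticInvariant :=
      hg.elim (glSubst_basic_of_eq_diag hs) (glSubst_basic_of_eq_smul hs)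
    have hle : Algebra.adjoin ℂ {quarticInvariant, sexticInvariant} ≤
        AlgHom.equalizer (glSubst g) (AlgHom.id ℂ _) := by
      refine Algebra.adjoin_le ?_
      rintro x (rfl | rfl)
      · exact hg4
      · exact hg6
    exact hle hp
end
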